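/- (Sharp L² Gagliardo–Nirenberg trace inequality.) Let m,n ≥ 1, let 0 < α_k < n for k = 1,…,m, and assume α = Σ α_k > (m−1)n. Then for every f ∈ 𝒮(ℝ^{mn}), ∫_{ℝ^n} |f(x,…,x)|² dx ≤ [∫_{ℝ^n} Π_{k=1}^m G_{α_k}(x) dx] · Λ_*(f; α_1,…,α_m), and ∫_{ℝ^n} Π_{k=1}^m G_{α_k}(x) dx is the least constant for which this holds for all Schwartz f. -/

import Mathlib

open MeasureTheory Real
open scoped ENNReal InnerProductSpace

noncomputable section

/-- The Bessel kernel `G_a` on `ℝ^n`. -/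
def besselG (n : ℕ) (a : ℝ) (x : EuclideanSpace ℝ (Fin n)) : ℝ :=
  (4 * Real.pi) ^ (-(a / 2)) * (Real.Gamma (a / 2))⁻¹ *
    ∫ δ in Set.Ioi (0 : ℝ),
      Real.exp (-(Real.pi * ‖x‖ ^ 2) / δ) * Real.exp (-δ / (4 * Real.pi)) *
        δ ^ ((a - (n : ℝ)) / 2 - 1)

/-- Fourier transform with kernel `e^{2πi x·ξ}` on `(ℝ^n)^m`. -/
def fourierM {m n : ℕ} (f : (Fin m → EuclideanSpace ℝ (Fin n)) → ℂ)
    (ξ : Fin m → EuclideanSpace ℝ (Fin n)) : ℂ :=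
  ∫ x, Complex.exp (2 * Real.pi * Complex.I * ((∑ k, ⟪x k, ξ k⟫_ℝ : ℝ) : ℂ)) * f x

/-- The inhomogeneous multilinear Dirichlet form
`Λ_*(f; α_1,…,α_m) = ∫ Π_k (1+4π²|ξ_k|²)^{α_k/2} |f̂(ξ)|² dξ`. -/
def LamStar {m n : ℕ} (f : (Fin m → EuclideanSpace ℝ (Fin n)) → ℂ)
    (α : Fin m → ℝ) : ℝ≥0∞ :=
  ∫⁻ ξ, (∏ k, ENNReal.ofReal ((1 + 4 * Real.pi ^ 2 * ‖ξ k‖ ^ 2) ^ (α k / 2))) *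
    (‖fourierM f ξ‖₊ : ℝ≥0∞) ^ (2 : ℕ)

/-- Splitting `ℝ^{mn}` into `m` blocks of length `n`. -/
def blockEquiv (m n : ℕ) :
    EuclideanSpace ℝ (Fin m × Fin n) ≃L[ℝ] (Fin m → EuclideanSpace ℝ (Fin n)) :=
  LinearEquiv.toContinuousLinearEquiv
    { toFun := fun u k => WithLp.toLp 2 (fun j => u (k, j))
      invFun := fun x => WithLp.toLp 2 (fun p => x p.1 p.2)
      map_add' := fun _ _ => rfl
      map_smul' := fun _ _ => rfl
      left_inv := fun _ => rfl
      right_inv := fun _ => rfl }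

@[simp]
lemma blockEquiv_apply {m n : ℕ} (u : EuclideanSpace ℝ (Fin m × Fin n)) (k : Fin m) (j : Fin n) :
    blockEquiv m n u k j = u (k, j) := rfl

lemma inner_eq_sum_inner_blockEquiv {m n : ℕ} (u v : EuclideanSpace ℝ (Fin m × Fin n)) :
    ⟪u, v⟫_ℝ = ∑ k, ⟪blockEquiv m n u k, blockEquiv m n v k⟫_ℝ := by
  simp [PiLp.inner_apply, Fintype.sum_prod_type]

lemma measurePreserving_blockEquiv (m n : ℕ) : MeasurePreserving (blockEquiv m n) := by
  refine ⟨(blockEquiv m n).continuous.measurable, ?_⟩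
  set ν : Measure (Fin m → EuclideanSpace ℝ (Fin n)) := Measure.map (blockEquiv m n) volume
  have hν : ν.IsAddHaarMeasure := (blockEquiv m n).isAddHaarMeasure_map _
  have hI : MeasurableSet (Set.Icc (0 : Fin n → ℝ) 1) := measurableSet_Icc
  let s : Set (EuclideanSpace ℝ (Fin n)) := WithLp.ofLp ⁻¹' Set.Icc (0 : Fin n → ℝ) 1
  have hs : MeasurableSet s := (PiLp.volume_preserving_ofLp (Fin n)).measurable hI
  have hvs : volume s = 1 := by
    rw [(PiLp.volume_preserving_ofLp (Fin n)).measure_preimage hI.nullMeasurableSet,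
      Real.volume_Icc_pi]
    simp
  have hT : MeasurableSet (Set.univ.pi fun _ : Fin m => s) :=
    MeasurableSet.univ_pi fun _ => hs
  have hvol : volume (Set.univ.pi fun _ : Fin m => s) = 1 := by
    rw [volume_pi_pi]; simp [hvs]
  have hνT : ν (Set.univ.pi fun _ : Fin m => s) = 1 := by
    have hpre : blockEquiv m n ⁻¹' (Set.univ.pi fun _ : Fin m => s) =
        WithLp.ofLp ⁻¹' Set.Icc (0 : Fin m × Fin n → ℝ) 1 := by
      ext u
      simp only [s, Set.mem_preimage, Set.mem_pi, Set.mem_univ, true_implies, Set.mem_Icc,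
        Pi.le_def, Prod.forall, forall_and]
      rfl
    rw [Measure.map_apply (blockEquiv m n).continuous.measurable hT, hpre,
      (PiLp.volume_preserving_ofLp _).measure_preimage measurableSet_Icc.nullMeasurableSet,
      Real.volume_Icc_pi]
    simp
  have h := Measure.isAddLeftInvariant_eq_smul ν volume
  rw [h, Measure.smul_apply, hvol] at hνT
  have hc : Measure.addHaarScalarFactor ν volume = 1 := by
    simpa [ENNReal.smul_def] using hνT
  rw [h, hc, one_smul]

open FourierTransform in
lemma fourierM_eq_fourierInv {m n : ℕ} (f : (Fin m → EuclideanSpace ℝ (Fin n)) → ℂ)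
    (u : EuclideanSpace ℝ (Fin m × Fin n)) :
    fourierM f (blockEquiv m n u) = 𝓕⁻ (f ∘ blockEquiv m n) u := by
  rw [fourierM, Real.fourierInv_eq', ← (measurePreserving_blockEquiv m n).integral_comp
    (blockEquiv m n).toHomeomorph.measurableEmbedding]
  refine integral_congr_ae (.of_forall fun v => ?_)
  simp only [Function.comp_apply, inner_eq_sum_inner_blockEquiv, smul_eq_mul]
  congr 2
  push_cast
  ring

/-- A Schwartz function on `(ℝ^n)^m` read on `ℝ^{mn}`. -/
def toFlat {m n : ℕ} (f : SchwartzMap (Fin m → EuclideanSpace ℝ (Fin n)) ℂ) :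
    SchwartzMap (EuclideanSpace ℝ (Fin m × Fin n)) ℂ :=
  SchwartzMap.compCLMOfContinuousLinearEquiv ℂ (blockEquiv m n) f

open FourierTransform in
lemma fourierM_eq_comp {m n : ℕ} (f : SchwartzMap (Fin m → EuclideanSpace ℝ (Fin n)) ℂ) :
    fourierM (fun x => f x) =
      ⇑(𝓕⁻ (toFlat f) : SchwartzMap (EuclideanSpace ℝ (Fin m × Fin n)) ℂ) ∘
        (blockEquiv m n).symm := by
  funext ξ
  obtain ⟨u, rfl⟩ := (blockEquiv m n).surjective ξ
  rw [fourierM_eq_fourierInv]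
  simp only [Function.comp_apply, ContinuousLinearEquiv.symm_apply_apply,
    SchwartzMap.fourierInv_coe]
  rfl

lemma continuous_fourierM {m n : ℕ} (f : SchwartzMap (Fin m → EuclideanSpace ℝ (Fin n)) ℂ) :
    Continuous (fourierM fun x => f x) := by
  rw [fourierM_eq_comp]
  exact (SchwartzMap.continuous (F := ℂ) _).comp (blockEquiv m n).symm.continuous

open FourierTransform in
lemma integrable_fourierM {m n : ℕ} (f : SchwartzMap (Fin m → EuclideanSpace ℝ (Fin n)) ℂ) :
    Integrable (fourierM fun x => f x) := by
  rw [← (measurePreserving_blockEquiv m n).integrable_comp_emb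
    (blockEquiv m n).toHomeomorph.measurableEmbedding, fourierM_eq_comp]
  simpa [Function.comp_assoc] using
    (𝓕⁻ (toFlat f) : SchwartzMap (EuclideanSpace ℝ (Fin m × Fin n)) ℂ).integrable

open FourierTransform in
lemma eq_integral_fourierM {m n : ℕ} (f : SchwartzMap (Fin m → EuclideanSpace ℝ (Fin n)) ℂ)
    (x : Fin m → EuclideanSpace ℝ (Fin n)) :
    f x = ∫ ξ, Complex.exp (-(2 * Real.pi * Complex.I * ((∑ k, ⟪x k, ξ k⟫_ℝ : ℝ) : ℂ))) *
      fourierM (fun x => f x) ξ := by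
  obtain ⟨u, rfl⟩ := (blockEquiv m n).surjective x
  have h1 : f (blockEquiv m n u) = 𝓕 (𝓕⁻ (toFlat f)) u := by
    rw [FourierTransform.fourier_fourierInv_eq]; rfl
  rw [h1, SchwartzMap.fourier_coe, Real.fourier_eq',
    ← (measurePreserving_blockEquiv m n).integral_comp
    (blockEquiv m n).toHomeomorph.measurableEmbedding, fourierM_eq_comp]
  refine integral_congr_ae (.of_forall fun v => ?_)
  simp only [Function.comp_apply, inner_eq_sum_inner_blockEquiv, smul_eq_mul,
    ContinuousLinearEquiv.symm_apply_apply, real_inner_comm]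
  congr 2
  push_cast
  ring

open FourierTransform in
lemma exists_fourierM_eq {m n : ℕ} (F : SchwartzMap (Fin m → EuclideanSpace ℝ (Fin n)) ℂ) :
    ∃ f : SchwartzMap (Fin m → EuclideanSpace ℝ (Fin n)) ℂ, fourierM (fun x => f x) = F := by
  refine ⟨SchwartzMap.compCLMOfContinuousLinearEquiv ℂ (blockEquiv m n).symm (𝓕 (toFlat F)), ?_⟩
  have h : toFlat (SchwartzMap.compCLMOfContinuousLinearEquiv ℂ (blockEquiv m n).symm
      (𝓕 (toFlat F))) = 𝓕 (toFlat F) := by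
    ext u; simp [toFlat]
  rw [fourierM_eq_comp, h, FourierTransform.fourierInv_fourier_eq]
  funext ξ
  simp [toFlat]

/-- The law of the subordination parameter of the Bessel kernel of order `a`. -/
def subordinator (a : ℝ) : Measure ℝ :=
  ProbabilityTheory.gammaMeasure (a / 2) (1 / (4 * π))

lemma isProbabilityMeasure_subordinator {a : ℝ} (ha : 0 < a) :
    IsProbabilityMeasure (subordinator a) :=
  ProbabilityTheory.isProbabilityMeasure_gammaMeasure (by positivity) (by positivity)

lemma lintegral_subordinator (a : ℝ) {φ : ℝ → ℝ≥0∞} :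
    ∫⁻ δ, φ δ ∂(subordinator a) = ∫⁻ δ in Set.Ioi (0 : ℝ),
      ENNReal.ofReal ((1 / (4 * π)) ^ (a / 2) / Real.Gamma (a / 2) * δ ^ (a / 2 - 1) *
        Real.exp (-(1 / (4 * π) * δ))) * φ δ := by
  have hm : Measurable (ProbabilityTheory.gammaPDF (a / 2) (1 / (4 * π))) :=
    (ProbabilityTheory.measurable_gammaPDFReal _ _).ennreal_ofReal
  rw [subordinator, ProbabilityTheory.gammaMeasure,
    lintegral_withDensity_eq_lintegral_mul_non_measurable₀ _ hm.aemeasurable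
      (.of_forall fun _ => ENNReal.ofReal_lt_top), setLIntegral_congr Ioi_ae_eq_Ici,
    ← lintegral_indicator measurableSet_Ici]
  refine lintegral_congr fun δ => ?_
  by_cases h : 0 ≤ δ
  · rw [Set.indicator_of_mem (by exact h), Pi.mul_apply,
      ProbabilityTheory.gammaPDF_of_nonneg h]
  · rw [Set.indicator_of_notMem (by exact h), Pi.mul_apply,
      ProbabilityTheory.gammaPDF_of_neg (not_le.1 h), zero_mul]

lemma ae_pos_subordinator (a : ℝ) : ∀ᵐ δ ∂(subordinator a), 0 < δ := by
  have h : ∫⁻ δ, (Set.Iic (0 : ℝ)).indicator 1 δ ∂(subordinator a) = 0 := by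
    rw [lintegral_subordinator, setLIntegral_congr_fun (g := 0) measurableSet_Ioi]
    · simp
    · intro δ hδ
      simp [Set.indicator_of_notMem (Set.notMem_Iic.2 (Set.mem_Ioi.1 hδ))]
  rw [lintegral_indicator_one measurableSet_Iic] at h
  rw [ae_iff]
  simpa [Set.Iic] using h

lemma lintegral_rpow_mul_exp_neg {s r : ℝ} (hs : 0 < s) (hr : 0 < r) :
    ∫⁻ t in Set.Ioi (0 : ℝ), ENNReal.ofReal (t ^ (s - 1) * Real.exp (-(r * t))) =
      ENNReal.ofReal ((1 / r) ^ s * Real.Gamma s) := by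
  have hint := Real.integral_rpow_mul_exp_neg_mul_Ioi hs hr
  rw [← hint, ofReal_integral_eq_lintegral_ofReal]
  · refine Integrable.of_integral_ne_zero ?_
    rw [hint]
    have := Real.Gamma_pos_of_pos hs
    positivity
  · refine (ae_restrict_mem measurableSet_Ioi).mono fun t ht => ?_
    have : 0 < t := ht
    simp only [Pi.zero_apply]
    positivity

/-- The subordination formula for the Bessel potential multiplier. -/
lemma lintegral_exp_subordinator {a : ℝ} (ha : 0 < a) {q : ℝ} (hq : 0 ≤ q) :
    ∫⁻ δ, ENNReal.ofReal (Real.exp (-(π * δ * q))) ∂(subordinator a) =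
      ENNReal.ofReal ((1 + 4 * π ^ 2 * q) ^ (-(a / 2))) := by
  have hΓ := Real.Gamma_pos_of_pos (half_pos ha)
  have hr : 0 < 1 / (4 * π) + π * q := by positivity
  have h1 : ∀ δ : ℝ, ENNReal.ofReal ((1 / (4 * π)) ^ (a / 2) / Real.Gamma (a / 2) *
      δ ^ (a / 2 - 1) * Real.exp (-(1 / (4 * π) * δ))) * ENNReal.ofReal (Real.exp (-(π * δ * q))) =
      ENNReal.ofReal ((1 / (4 * π)) ^ (a / 2) / Real.Gamma (a / 2)) *
        ENNReal.ofReal (δ ^ (a / 2 - 1) * Real.exp (-((1 / (4 * π) + π * q) * δ))) := by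
    intro δ
    rw [← ENNReal.ofReal_mul' (by positivity), ← ENNReal.ofReal_mul (by positivity), mul_assoc,
      ← Real.exp_add, mul_assoc]
    congr 4
    ring
  rw [lintegral_subordinator]
  simp_rw [h1]
  rw [lintegral_const_mul _ (by fun_prop), lintegral_rpow_mul_exp_neg (half_pos ha) hr,
    ← ENNReal.ofReal_mul (by positivity)]
  congr 1
  have h2 : 1 / (4 * π) + π * q = 1 / (4 * π) * (1 + 4 * π ^ 2 * q) := by
    field_simp
  have hp : (0 : ℝ) < (1 / (4 * π)) ^ (a / 2) := by positivity
  have hp' : (0 : ℝ) < (1 + 4 * π ^ 2 * q) ^ (a / 2) := by positivity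
  rw [h2, one_div (1 / (4 * π) * _), Real.inv_rpow (by positivity),
    Real.mul_rpow (by positivity) (by positivity), Real.rpow_neg (by positivity)]
  field_simp

lemma lintegral_rpow_subordinator_lt_top {a s : ℝ} (hs : s < a / 2) :
    ∫⁻ δ, ENNReal.ofReal (δ ^ (-s)) ∂(subordinator a) < ⊤ := by
  rw [lintegral_subordinator, setLIntegral_congr_fun
    (g := fun δ => ENNReal.ofReal ((1 / (4 * π)) ^ (a / 2) / Real.Gamma (a / 2)) *
        ENNReal.ofReal (δ ^ ((a / 2 - s) - 1) * Real.exp (-(1 / (4 * π) * δ)))) measurableSet_Ioi]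
  · rw [lintegral_const_mul _ (by fun_prop),
      lintegral_rpow_mul_exp_neg (sub_pos.2 hs) (by positivity)]
    exact ENNReal.mul_lt_top ENNReal.ofReal_lt_top ENNReal.ofReal_lt_top
  · intro δ hδ
    have hδ : 0 < δ := hδ
    simp only
    rw [← ENNReal.ofReal_mul' (by positivity), ← ENNReal.ofReal_mul' (by positivity),
      show a / 2 - s - 1 = (a / 2 - 1) + -s by ring, Real.rpow_add hδ]
    congr 1
    ring

/-- The Bessel kernel as a superposition of normalised Gaussians. -/
lemma besselG_eq_toReal {n : ℕ} {a : ℝ} (ha : 0 < a) (x : EuclideanSpace ℝ (Fin n)) :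
    besselG n a x = (∫⁻ δ, ENNReal.ofReal (δ ^ (-((n : ℝ) / 2)) *
      Real.exp (-(π * ‖x‖ ^ 2 / δ))) ∂(subordinator a)).toReal := by
  have hΓ := Real.Gamma_pos_of_pos (half_pos ha)
  have h : ∫⁻ δ, ENNReal.ofReal (δ ^ (-((n : ℝ) / 2)) * Real.exp (-(π * ‖x‖ ^ 2 / δ)))
        ∂(subordinator a) =
      ENNReal.ofReal ((1 / (4 * π)) ^ (a / 2) / Real.Gamma (a / 2)) *
        ∫⁻ δ in Set.Ioi (0 : ℝ), ENNReal.ofReal (Real.exp (-(π * ‖x‖ ^ 2) / δ) *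
          Real.exp (-δ / (4 * π)) * δ ^ ((a - (n : ℝ)) / 2 - 1)) := by
    rw [lintegral_subordinator, ← lintegral_const_mul _ (by fun_prop)]
    refine setLIntegral_congr_fun measurableSet_Ioi fun δ hδ => ?_
    have hδ : 0 < δ := hδ
    rw [← ENNReal.ofReal_mul' (by positivity), ← ENNReal.ofReal_mul' (by positivity),
      show (a - (n : ℝ)) / 2 - 1 = (a / 2 - 1) + -((n : ℝ) / 2) by ring, Real.rpow_add hδ,
      neg_div, neg_div, one_div_mul_eq_div]
    congr 1
    ring
  rw [h, besselG, integral_eq_lintegral_of_nonneg_ae, ENNReal.toReal_mul,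
    ENNReal.toReal_ofReal (by positivity)]
  · rw [one_div, Real.inv_rpow (by positivity), Real.rpow_neg (by positivity),
      ← div_eq_mul_inv]
  · refine (ae_restrict_mem measurableSet_Ioi).mono fun t ht => ?_
    have : 0 < t := ht
    simp only [Pi.zero_apply]
    positivity
  · exact (by fun_prop : Measurable _).aestronglyMeasurable

lemma lintegral_gaussian {n : ℕ} {b : ℝ} (hb : 0 < b) :
    ∫⁻ x : EuclideanSpace ℝ (Fin n), ENNReal.ofReal (Real.exp (-(π * b * ‖x‖ ^ 2))) =
      ENNReal.ofReal (b ^ (-((n : ℝ) / 2))) := by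
  have hint := GaussianFourier.integral_rexp_neg_mul_sq_norm
    (V := EuclideanSpace ℝ (Fin n)) (mul_pos pi_pos hb)
  have hq : π / (π * b) = b⁻¹ := by field_simp
  rw [hq, finrank_euclideanSpace_fin, Real.inv_rpow hb.le, ← Real.rpow_neg hb.le] at hint
  simp_rw [neg_mul] at hint
  rw [← hint, ofReal_integral_eq_lintegral_ofReal]
  · refine Integrable.of_integral_ne_zero ?_
    rw [hint]
    positivity
  · exact .of_forall fun x => (Real.exp_pos _).le

lemma lintegral_gaussian_mul_gaussian_sub {n : ℕ} {a b : ℝ} (ha : 0 < a) (hb : 0 < b)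
    (η : EuclideanSpace ℝ (Fin n)) :
    ∫⁻ ξ : EuclideanSpace ℝ (Fin n), ENNReal.ofReal (Real.exp (-(π * a * ‖ξ‖ ^ 2))) *
        ENNReal.ofReal (Real.exp (-(π * b * ‖η - ξ‖ ^ 2))) =
      ENNReal.ofReal ((a + b) ^ (-((n : ℝ) / 2)) *
        Real.exp (-(π * (a * b / (a + b)) * ‖η‖ ^ 2))) := by
  have hab : 0 < a + b := by positivity
  have h1 : ∀ ξ : EuclideanSpace ℝ (Fin n), ENNReal.ofReal (Real.exp (-(π * a * ‖ξ‖ ^ 2))) *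
        ENNReal.ofReal (Real.exp (-(π * b * ‖η - ξ‖ ^ 2))) =
      ENNReal.ofReal (Real.exp (-(π * (a * b / (a + b)) * ‖η‖ ^ 2))) *
        ENNReal.ofReal (Real.exp (-(π * (a + b) * ‖ξ - (b / (a + b)) • η‖ ^ 2))) := by
    intro ξ
    rw [← ENNReal.ofReal_mul (by positivity), ← ENNReal.ofReal_mul (by positivity),
      ← Real.exp_add, ← Real.exp_add, norm_sub_sq_real, norm_sub_sq_real, norm_smul,
      inner_smul_right, real_inner_comm, mul_pow, Real.norm_eq_abs, sq_abs]
    congr 2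
    field_simp
    ring
  simp_rw [h1]
  rw [lintegral_const_mul _ (by fun_prop), lintegral_sub_right_eq_self
    (fun ξ => ENNReal.ofReal (Real.exp (-(π * (a + b) * ‖ξ‖ ^ 2)))), lintegral_gaussian hab,
    ← ENNReal.ofReal_mul (by positivity), mul_comm]

/-- The total mass factor of the convolution of `m` Gaussians with parameters `δ`. -/
def gaussFactor (n : ℕ) {m : ℕ} (δ : Fin m → ℝ) : ℝ :=
  (∏ k, δ k ^ (-((n : ℝ) / 2))) * (∑ k, (δ k)⁻¹) ^ (-((n : ℝ) / 2))

lemma gaussFactor_nonneg {n m : ℕ} {δ : Fin m → ℝ} (hδ : ∀ k, 0 < δ k) :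
    0 ≤ gaussFactor n δ :=
  mul_nonneg (Finset.prod_nonneg fun k _ => (Real.rpow_pos_of_pos (hδ k) _).le)
    (Real.rpow_nonneg (Finset.sum_nonneg fun k _ => (inv_pos.2 (hδ k)).le) _)

lemma sum_inv_pos {m : ℕ} (hm : 1 ≤ m) {δ : Fin m → ℝ} (hδ : ∀ k, 0 < δ k) :
    0 < ∑ k, (δ k)⁻¹ := by
  have : Nonempty (Fin m) := ⟨⟨0, hm⟩⟩
  exact Finset.sum_pos (fun k _ => inv_pos.2 (hδ k)) Finset.univ_nonempty

lemma gaussFactor_cons {n m : ℕ} (hm : 1 ≤ m) {δ : Fin (m + 1) → ℝ} (hδ : ∀ k, 0 < δ k) :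
    gaussFactor n (fun k => δ (Fin.succ k)) *
      (δ 0 + (∑ k : Fin m, (δ k.succ)⁻¹)⁻¹) ^ (-((n : ℝ) / 2)) = gaussFactor n δ := by
  have hS := sum_inv_pos hm (δ := fun k => δ (Fin.succ k)) fun k => hδ _
  have h0 := hδ 0
  simp only [gaussFactor, Fin.prod_univ_succ, Fin.sum_univ_succ]
  set S := ∑ k : Fin m, (δ k.succ)⁻¹
  have h : S * (δ 0 + S⁻¹) = δ 0 * ((δ 0)⁻¹ + S) := by field_simp; ring
  rw [mul_assoc, ← Real.mul_rpow hS.le (by positivity), h,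
    Real.mul_rpow h0.le (by positivity)]
  ring

lemma lintegral_prod_gaussian_mul_comp_sum {n m : ℕ} (hm : 1 ≤ m) {δ : Fin m → ℝ}
    (hδ : ∀ k, 0 < δ k) {ψ : EuclideanSpace ℝ (Fin n) → ℝ≥0∞} (hψ : Measurable ψ) :
    ∫⁻ ξ : Fin m → EuclideanSpace ℝ (Fin n),
        (∏ k, ENNReal.ofReal (Real.exp (-(π * δ k * ‖ξ k‖ ^ 2)))) * ψ (∑ k, ξ k) =
      ∫⁻ η, ψ η * ENNReal.ofReal (gaussFactor n δ *
        Real.exp (-(π * (∑ k, (δ k)⁻¹)⁻¹ * ‖η‖ ^ 2))) := by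
  induction m, hm using Nat.le_induction generalizing ψ with
  | base =>
    rw [← (volume_preserving_funUnique (Fin 1) (EuclideanSpace ℝ (Fin n))).lintegral_comp_emb
      (MeasurableEquiv.measurableEmbedding _)]
    refine lintegral_congr fun ξ => ?_
    have h0 := hδ 0
    have : gaussFactor n δ = 1 := by
      simp only [gaussFactor, Fin.prod_univ_one, Fin.sum_univ_one]
      rw [← Real.mul_rpow h0.le (by positivity), mul_inv_cancel₀ h0.ne', Real.one_rpow]
    simp [this, mul_comm]
  | succ m hm ih =>
    have hS := sum_inv_pos hm (δ := fun k => δ (Fin.succ k)) fun k => hδ _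
    have h0 := hδ 0
    rw [← (volume_preserving_piFinSuccAbove (fun _ : Fin (m + 1) => EuclideanSpace ℝ (Fin n))
      0).symm.lintegral_comp_emb (MeasurableEquiv.measurableEmbedding _), Measure.volume_eq_prod,
      lintegral_prod _ (by
        refine AEMeasurable.mul ?_ ?_
        · fun_prop
        · fun_prop)]
    simp only [MeasurableEquiv.piFinSuccAbove_symm_apply, Fin.insertNthEquiv_zero,
      Fin.consEquiv_apply, Fin.prod_univ_succ, Fin.sum_univ_succ, Fin.cons_zero, Fin.cons_succ]
    have step : ∀ ξ₀ : EuclideanSpace ℝ (Fin n),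
        ∫⁻ ξ : Fin m → EuclideanSpace ℝ (Fin n),
          ENNReal.ofReal (Real.exp (-(π * δ 0 * ‖ξ₀‖ ^ 2))) *
            (∏ k, ENNReal.ofReal (Real.exp (-(π * δ (Fin.succ k) * ‖ξ k‖ ^ 2)))) *
              ψ (ξ₀ + ∑ k, ξ k) =
        ∫⁻ η, ψ η * ENNReal.ofReal (gaussFactor n fun k => δ (Fin.succ k)) *
          (ENNReal.ofReal (Real.exp (-(π * δ 0 * ‖ξ₀‖ ^ 2))) * ENNReal.ofReal
            (Real.exp (-(π * (∑ k : Fin m, (δ k.succ)⁻¹)⁻¹ * ‖η - ξ₀‖ ^ 2)))) := by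
      intro ξ₀
      rw [lintegral_congr fun ξ => mul_assoc _ _ _, lintegral_const_mul _ (by fun_prop),
        ih (δ := fun k => δ (Fin.succ k)) (fun k => hδ _) (ψ := fun η => ψ (ξ₀ + η)) (by fun_prop),
        ← lintegral_const_mul _ (by fun_prop)]
      conv_rhs => rw [← lintegral_add_left_eq_self _ ξ₀]
      refine lintegral_congr fun η => ?_
      rw [add_sub_cancel_left, ENNReal.ofReal_mul (gaussFactor_nonneg fun k => hδ _)]
      ring
    simp_rw [step]
    rw [lintegral_lintegral_swap (by fun_prop)]
    refine lintegral_congr fun η => ?_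
    rw [lintegral_const_mul _ (by fun_prop),
      lintegral_gaussian_mul_gaussian_sub h0 (inv_pos.2 hS), mul_assoc,
      ← ENNReal.ofReal_mul (gaussFactor_nonneg fun k => hδ _), ← mul_assoc (gaussFactor _ _),
      gaussFactor_cons hm hδ]
    set S := ∑ k : Fin m, (δ k.succ)⁻¹
    have hinv : δ 0 * S⁻¹ / (δ 0 + S⁻¹) = ((δ 0)⁻¹ + S)⁻¹ := by
      field_simp
      ring
    rw [hinv]

lemma lintegral_pi_prod {m : ℕ} (μ : Fin m → Measure ℝ) [∀ k, IsProbabilityMeasure (μ k)]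
    {φ : Fin m → ℝ → ℝ≥0∞} (hφ : ∀ k, Measurable (φ k)) :
    ∫⁻ δ, ∏ k, φ k (δ k) ∂(Measure.pi μ) = ∏ k, ∫⁻ t, φ k t ∂(μ k) := by
  rw [ProbabilityTheory.lintegral_prod_eq_prod_lintegral_of_indepFun _
    (fun k (δ : Fin m → ℝ) => φ k (δ k))
    (ProbabilityTheory.iIndepFun_pi fun k => (hφ k).aemeasurable)
    fun k => (hφ k).comp (measurable_pi_apply k)]
  exact Finset.prod_congr rfl fun k _ => (measurePreserving_eval μ k).lintegral_comp (hφ k)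

/-- The joint law of independent subordination parameters. -/
def jointSubordinator {m : ℕ} (α : Fin m → ℝ) : Measure (Fin m → ℝ) :=
  Measure.pi fun k => subordinator (α k)

lemma isProbabilityMeasure_jointSubordinator {m : ℕ} {α : Fin m → ℝ} (hα : ∀ k, 0 < α k) :
    IsProbabilityMeasure (jointSubordinator α) := by
  have := fun k => isProbabilityMeasure_subordinator (hα k)
  unfold jointSubordinator
  infer_instance

lemma ae_pos_jointSubordinator {m : ℕ} {α : Fin m → ℝ} (hα : ∀ k, 0 < α k) :
    ∀ᵐ δ ∂(jointSubordinator α), ∀ k, 0 < δ k := by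
  have := fun k => isProbabilityMeasure_subordinator (hα k)
  refine ae_all_iff.2 fun k => ?_
  exact (Measure.quasiMeasurePreserving_eval (fun k => subordinator (α k)) k).ae
    (ae_pos_subordinator (α k))

@[fun_prop]
lemma measurable_gaussFactor (n m : ℕ) : Measurable (gaussFactor n : (Fin m → ℝ) → ℝ) := by
  unfold gaussFactor
  fun_prop

/-- The convolution of the Bessel potential multipliers of orders `α k`, written as a superposition
of Gaussians. -/
def multiplierConv (n : ℕ) {m : ℕ} (α : Fin m → ℝ) (η : EuclideanSpace ℝ (Fin n)) : ℝ≥0∞ :=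
  ∫⁻ δ, ENNReal.ofReal (gaussFactor n δ * Real.exp (-(π * (∑ k, (δ k)⁻¹)⁻¹ * ‖η‖ ^ 2)))
    ∂(jointSubordinator α)

lemma lintegral_multiplier_mul_comp_sum {n m : ℕ} (hm : 1 ≤ m) {α : Fin m → ℝ}
    (hα : ∀ k, 0 < α k) {ψ : EuclideanSpace ℝ (Fin n) → ℝ≥0∞} (hψ : Measurable ψ) :
    ∫⁻ ξ : Fin m → EuclideanSpace ℝ (Fin n),
        (∏ k, ENNReal.ofReal ((1 + 4 * π ^ 2 * ‖ξ k‖ ^ 2) ^ (-(α k / 2)))) * ψ (∑ k, ξ k) =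
      ∫⁻ η, ψ η * multiplierConv n α η := by
  have := fun k => isProbabilityMeasure_subordinator (hα k)
  have := isProbabilityMeasure_jointSubordinator hα
  have h1 : ∀ ξ : Fin m → EuclideanSpace ℝ (Fin n),
      (∏ k, ENNReal.ofReal ((1 + 4 * π ^ 2 * ‖ξ k‖ ^ 2) ^ (-(α k / 2)))) * ψ (∑ k, ξ k) =
      ∫⁻ δ, (∏ k, ENNReal.ofReal (Real.exp (-(π * δ k * ‖ξ k‖ ^ 2)))) * ψ (∑ k, ξ k)
        ∂(jointSubordinator α) := by
    intro ξ
    rw [lintegral_mul_const _ (by fun_prop), jointSubordinator, lintegral_pi_prod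
      (φ := fun k δ => ENNReal.ofReal (Real.exp (-(π * δ * ‖ξ k‖ ^ 2)))) _ (by fun_prop)]
    simp_rw [lintegral_exp_subordinator (hα _) (sq_nonneg _)]
  simp_rw [h1, multiplierConv]
  rw [lintegral_lintegral_swap (by fun_prop), lintegral_congr_ae
    ((ae_pos_jointSubordinator hα).mono fun δ hδ =>
      lintegral_prod_gaussian_mul_comp_sum hm hδ hψ), lintegral_lintegral_swap (by fun_prop)]
  exact lintegral_congr fun η => lintegral_const_mul _ (by fun_prop)

lemma multiplierConv_le {n m : ℕ} {α : Fin m → ℝ} (hα : ∀ k, 0 < α k)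
    (η : EuclideanSpace ℝ (Fin n)) : multiplierConv n α η ≤ multiplierConv n α 0 := by
  refine lintegral_mono_ae ((ae_pos_jointSubordinator hα).mono fun δ hδ => ?_)
  refine ENNReal.ofReal_le_ofReal (mul_le_mul_of_nonneg_left ?_ (gaussFactor_nonneg hδ))
  have : 0 ≤ ∑ k, (δ k)⁻¹ := Finset.sum_nonneg fun k _ => (inv_pos.2 (hδ k)).le
  rw [Real.exp_le_exp, norm_zero, neg_le_neg_iff]
  simp only [ne_eq, OfNat.ofNat_ne_zero, not_false_eq_true, zero_pow, mul_zero]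
  positivity

lemma lintegral_prod_kernel_eq {n m : ℕ} (hm : 1 ≤ m) {α : Fin m → ℝ} (hα : ∀ k, 0 < α k) :
    ∫⁻ x : EuclideanSpace ℝ (Fin n), ∏ k, ∫⁻ δ, ENNReal.ofReal (δ ^ (-((n : ℝ) / 2)) *
      Real.exp (-(π * ‖x‖ ^ 2 / δ))) ∂(subordinator (α k)) = multiplierConv n α 0 := by
  have := fun k => isProbabilityMeasure_subordinator (hα k)
  have := isProbabilityMeasure_jointSubordinator hα
  have h1 : ∀ x : EuclideanSpace ℝ (Fin n), ∏ k, ∫⁻ δ, ENNReal.ofReal (δ ^ (-((n : ℝ) / 2)) *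
      Real.exp (-(π * ‖x‖ ^ 2 / δ))) ∂(subordinator (α k)) =
      ∫⁻ δ, ∏ k, ENNReal.ofReal (δ k ^ (-((n : ℝ) / 2)) * Real.exp (-(π * ‖x‖ ^ 2 / δ k)))
        ∂(jointSubordinator α) := fun x =>
    (lintegral_pi_prod (fun k => subordinator (α k)) (φ := fun _ δ => ENNReal.ofReal
      (δ ^ (-((n : ℝ) / 2)) * Real.exp (-(π * ‖x‖ ^ 2 / δ)))) (by fun_prop)).symm
  simp_rw [h1]
  rw [lintegral_lintegral_swap (by fun_prop)]
  refine lintegral_congr_ae ((ae_pos_jointSubordinator hα).mono fun δ hδ => ?_)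
  have h2 : ∀ x : EuclideanSpace ℝ (Fin n),
      ∏ k, ENNReal.ofReal (δ k ^ (-((n : ℝ) / 2)) * Real.exp (-(π * ‖x‖ ^ 2 / δ k))) =
      ENNReal.ofReal (∏ k, δ k ^ (-((n : ℝ) / 2))) *
        ENNReal.ofReal (Real.exp (-(π * (∑ k, (δ k)⁻¹) * ‖x‖ ^ 2))) := by
    intro x
    have hp : ∀ k, 0 ≤ δ k ^ (-((n : ℝ) / 2)) := fun k => Real.rpow_nonneg (hδ k).le _
    rw [← ENNReal.ofReal_prod_of_nonneg fun k _ => mul_nonneg (hp k) (Real.exp_pos _).le,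
      Finset.prod_mul_distrib, ← Real.exp_sum, ENNReal.ofReal_mul
      (Finset.prod_nonneg fun k _ => hp k), Finset.mul_sum, Finset.sum_mul,
      ← Finset.sum_neg_distrib]
    congr 3
    refine Finset.sum_congr rfl fun k _ => ?_
    ring
  simp_rw [h2]
  rw [lintegral_const_mul _ (by fun_prop), lintegral_gaussian (sum_inv_pos hm hδ),
    ← ENNReal.ofReal_mul (Finset.prod_nonneg fun k _ => Real.rpow_nonneg (hδ k).le _)]
  simp [gaussFactor]

lemma gaussFactor_le_prod {n m : ℕ} {δ θ : Fin m → ℝ} (hδ : ∀ k, 0 < δ k)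
    (hθ : ∀ k, 0 ≤ θ k) (hθ₁ : ∑ k, θ k = 1) :
    gaussFactor n δ ≤ ∏ k, δ k ^ (-((1 - θ k) * (n / 2))) := by
  have h1 : ∏ k, (δ k)⁻¹ ^ θ k ≤ ∑ k, (δ k)⁻¹ := by
    refine (Real.geom_mean_le_arith_mean_weighted _ θ _ (fun k _ => hθ k) hθ₁
      fun k _ => (inv_pos.2 (hδ k)).le).trans (Finset.sum_le_sum fun k _ => ?_)
    have : θ k ≤ 1 := hθ₁ ▸ Finset.single_le_sum (fun i _ => hθ i) (Finset.mem_univ k)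
    exact mul_le_of_le_one_left (inv_pos.2 (hδ k)).le this
  have h2 : 0 < ∏ k, (δ k)⁻¹ ^ θ k :=
    Finset.prod_pos fun k _ => Real.rpow_pos_of_pos (inv_pos.2 (hδ k)) _
  have hn : -((n : ℝ) / 2) ≤ 0 := by simp only [Left.neg_nonpos_iff]; positivity
  calc gaussFactor n δ
      ≤ (∏ k, δ k ^ (-((n : ℝ) / 2))) * (∏ k, (δ k)⁻¹ ^ θ k) ^ (-((n : ℝ) / 2)) :=
        mul_le_mul_of_nonneg_left (Real.rpow_le_rpow_of_nonpos h2 h1 hn)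
          (Finset.prod_nonneg fun k _ => Real.rpow_nonneg (hδ k).le _)
    _ = ∏ k, δ k ^ (-((1 - θ k) * (n / 2))) := by
        rw [← Real.finsetProd_rpow _ _ fun k _ => Real.rpow_nonneg (inv_pos.2 (hδ k)).le _,
          ← Finset.prod_mul_distrib]
        refine Finset.prod_congr rfl fun k _ => ?_
        rw [Real.inv_rpow (hδ k).le, ← Real.rpow_neg (hδ k).le, ← Real.rpow_mul (hδ k).le,
          ← Real.rpow_add (hδ k)]
        congr 1
        ring

lemma multiplierConv_zero_lt_top {n m : ℕ} (hm : 1 ≤ m) (hn : 1 ≤ n) {α : Fin m → ℝ}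
    (hα : ∀ k, 0 < α k ∧ α k < n) (hlow : ((m : ℝ) - 1) * n < ∑ k, α k) :
    multiplierConv n α 0 < ⊤ := by
  have := fun k => isProbabilityMeasure_subordinator (hα k).1
  have hn0 : (0 : ℝ) < n := by exact_mod_cast hn
  have hne : Nonempty (Fin m) := ⟨⟨0, hm⟩⟩
  have hβ : ∀ k, 0 < (n : ℝ) - α k := fun k => sub_pos.2 (hα k).2
  set B := ∑ k, ((n : ℝ) - α k) with hB
  have hB0 : 0 < B := Finset.sum_pos (fun k _ => hβ k) Finset.univ_nonempty
  have hBn : B < n := by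
    rw [hB, Finset.sum_sub_distrib]
    simp only [Finset.sum_const, Finset.card_univ, Fintype.card_fin, nsmul_eq_mul]
    linarith
  set θ : Fin m → ℝ := fun k => (n - α k) / B
  have hθ₁ : ∑ k, θ k = 1 := by
    rw [← Finset.sum_div]
    exact div_self hB0.ne'
  have hs : ∀ k, (1 - θ k) * (n / 2) < α k / 2 := by
    intro k
    have : (n - α k) / n < θ k := div_lt_div_of_pos_left (hβ k) hB0 hBn
    rw [div_lt_iff₀ hn0] at this
    linarith
  calc multiplierConv n α 0
      ≤ ∫⁻ δ, ∏ k, ENNReal.ofReal (δ k ^ (-((1 - θ k) * (n / 2)))) ∂(jointSubordinator α) := by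
        refine lintegral_mono_ae ((ae_pos_jointSubordinator fun k => (hα k).1).mono
          fun δ hδ => ?_)
        rw [← ENNReal.ofReal_prod_of_nonneg fun k _ => Real.rpow_nonneg (hδ k).le _]
        refine ENNReal.ofReal_le_ofReal ?_
        simpa using gaussFactor_le_prod hδ (fun k => (div_pos (hβ k) hB0).le) hθ₁
    _ = ∏ k, ∫⁻ δ, ENNReal.ofReal (δ ^ (-((1 - θ k) * (n / 2)))) ∂(subordinator (α k)) :=
        lintegral_pi_prod _ (φ := fun k δ => ENNReal.ofReal (δ ^ (-((1 - θ k) * (n / 2)))))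
          (by fun_prop)
    _ < ⊤ := ENNReal.prod_lt_top fun k _ => lintegral_rpow_subordinator_lt_top (hs k)

lemma ofReal_integral_prod_besselG {n m : ℕ} (hm : 1 ≤ m) (hn : 1 ≤ n) {α : Fin m → ℝ}
    (hα : ∀ k, 0 < α k ∧ α k < n) (hlow : ((m : ℝ) - 1) * n < ∑ k, α k) :
    ENNReal.ofReal (∫ x : EuclideanSpace ℝ (Fin n), ∏ k, besselG n (α k) x) =
      multiplierConv n α 0 := by
  have := fun k => isProbabilityMeasure_subordinator (hα k).1
  have hfin := multiplierConv_zero_lt_top hm hn hα hlow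
  have hK := lintegral_prod_kernel_eq (n := n) hm fun k => (hα k).1
  have hmeas : Measurable fun x : EuclideanSpace ℝ (Fin n) =>
      ∏ k, ∫⁻ δ, ENNReal.ofReal (δ ^ (-((n : ℝ) / 2)) *
        Real.exp (-(π * ‖x‖ ^ 2 / δ))) ∂(subordinator (α k)) :=
    Finset.measurable_fun_prod _ fun k _ => Measurable.lintegral_prod_right'
      (f := fun p : EuclideanSpace ℝ (Fin n) × ℝ => ENNReal.ofReal (p.2 ^ (-((n : ℝ) / 2)) *
        Real.exp (-(π * ‖p.1‖ ^ 2 / p.2)))) (by fun_prop)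
  simp_rw [besselG_eq_toReal (hα _).1, ← ENNReal.toReal_prod]
  rw [integral_toReal hmeas.aemeasurable (ae_lt_top hmeas (by rw [hK]; exact hfin.ne)), hK,
    ENNReal.ofReal_toReal hfin.ne]

lemma sq_lintegral_mul_le {X : Type*} [MeasurableSpace X] {μ : Measure X}
    {U V W W' : X → ℝ≥0∞} (hU : Measurable U) (hV : Measurable V) (hW : Measurable W)
    (hW' : Measurable W') (hWW' : ∀ x, W x * W' x = 1) :
    (∫⁻ x, U x * V x ∂μ) ^ 2 ≤ (∫⁻ x, W x * U x ^ 2 ∂μ) * ∫⁻ x, W' x * V x ^ 2 ∂μ := by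
  have hsq : ∀ a b : ℝ≥0∞, (a ^ (1 / 2 : ℝ) * b) ^ (2 : ℝ) = a * b ^ 2 := by
    intro a b
    rw [ENNReal.mul_rpow_of_nonneg _ _ zero_le_two, ← ENNReal.rpow_mul, ENNReal.rpow_two]
    norm_num
  have h := ENNReal.lintegral_mul_le_Lp_mul_Lq μ Real.HolderConjugate.two_two
    ((hW.pow_const (1 / 2 : ℝ)).mul hU).aemeasurable
    ((hW'.pow_const (1 / 2 : ℝ)).mul hV).aemeasurable
  have h1 : ∀ x, U x * V x = W x ^ (1 / 2 : ℝ) * U x * (W' x ^ (1 / 2 : ℝ) * V x) := by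
    intro x
    rw [mul_mul_mul_comm, ← ENNReal.mul_rpow_of_nonneg _ _ (by norm_num), hWW',
      ENNReal.one_rpow, one_mul]
  simp only [Pi.mul_apply, hsq, ← h1] at h
  calc (∫⁻ x, U x * V x ∂μ) ^ 2
      ≤ ((∫⁻ x, W x * U x ^ 2 ∂μ) ^ (1 / 2 : ℝ) * (∫⁻ x, W' x * V x ^ 2 ∂μ) ^ (1 / 2 : ℝ)) ^ 2 := by
        gcongr
    _ = _ := by
        rw [← ENNReal.mul_rpow_of_nonneg _ _ (by norm_num), ← ENNReal.rpow_two,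
          ← ENNReal.rpow_mul]
        norm_num

lemma le_of_sq_le_mul {x c : ℝ≥0∞} (hx : x ≠ ⊤) (h : x ^ 2 ≤ c * x) : x ≤ c := by
  rcases eq_or_ne x 0 with rfl | h0
  · exact zero_le
  · rw [pow_two] at h
    exact (ENNReal.mul_le_mul_iff_left h0 hx).1 h

open FourierTransform in
/-- Pairing of a diagonal trace with an integrable function, on the Fourier side. -/
lemma integral_diagonal_mul {n m : ℕ} (f : SchwartzMap (Fin m → EuclideanSpace ℝ (Fin n)) ℂ)
    {h : EuclideanSpace ℝ (Fin n) → ℂ} (hh : Integrable h) :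
    ∫ x, f (fun _ => x) * h x = ∫ ξ, fourierM (fun x => f x) ξ * 𝓕 h (∑ k, ξ k) := by
  let L : (Fin m → EuclideanSpace ℝ (Fin n)) →ₗ[ℝ] EuclideanSpace ℝ (Fin n) →ₗ[ℝ] ℝ :=
    (innerₗ (EuclideanSpace ℝ (Fin n))) ∘ₗ ∑ k, LinearMap.proj k
  have hL : ∀ ξ x, L ξ x = ⟪∑ k, ξ k, x⟫_ℝ := fun ξ x => by simp [L, sum_inner]
  have key := VectorFourier.integral_fourierIntegral_smul_eq_flip (μ := volume) (ν := volume)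
    (L := L) Real.continuous_fourierChar (by simp only [hL]; fun_prop)
    (integrable_fourierM f) hh
  convert key using 1
  · refine integral_congr_ae (.of_forall fun x => ?_)
    simp only [smul_eq_mul]
    rw [eq_integral_fourierM f, VectorFourier.fourierIntegral]
    congr 1
    refine integral_congr_ae (.of_forall fun ξ => ?_)
    simp only [hL, Circle.smul_def, smul_eq_mul, Real.fourierChar_apply, sum_inner]
    congr 2
    simp only [real_inner_comm x]
    push_cast
    ring
  · refine integral_congr_ae (.of_forall fun ξ => ?_)
    simp only [smul_eq_mul]
    rw [Real.fourier_eq, VectorFourier.fourierIntegral]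
    congr 1
    refine integral_congr_ae (.of_forall fun x => ?_)
    simp only [LinearMap.flip_apply, hL, real_inner_comm]

/-- The diagonal trace of a Schwartz function. -/
def diagonalTrace {n m : ℕ} (hm : 1 ≤ m)
    (f : SchwartzMap (Fin m → EuclideanSpace ℝ (Fin n)) ℂ) :
    SchwartzMap (EuclideanSpace ℝ (Fin n)) ℂ :=
  SchwartzMap.compCLMOfAntilipschitz ℂ
    (g := ContinuousLinearMap.pi fun _ : Fin m =>
      ContinuousLinearMap.id ℝ (EuclideanSpace ℝ (Fin n)))
    (ContinuousLinearMap.hasTemperateGrowth _)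
    (K := 1) (AntilipschitzWith.of_le_mul_dist fun x y => by
      rw [NNReal.coe_one, one_mul]
      exact dist_le_pi_dist (ContinuousLinearMap.pi (fun _ : Fin m =>
        ContinuousLinearMap.id ℝ (EuclideanSpace ℝ (Fin n))) x) (ContinuousLinearMap.pi
        (fun _ : Fin m => ContinuousLinearMap.id ℝ (EuclideanSpace ℝ (Fin n))) y) ⟨0, hm⟩) f

lemma diagonalTrace_apply {n m : ℕ} (hm : 1 ≤ m)
    (f : SchwartzMap (Fin m → EuclideanSpace ℝ (Fin n)) ℂ) (x : EuclideanSpace ℝ (Fin n)) :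
    diagonalTrace hm f x = f (fun _ => x) := rfl

lemma ofReal_integral_norm_sq {n : ℕ} (g : SchwartzMap (EuclideanSpace ℝ (Fin n)) ℂ) :
    ENNReal.ofReal (∫ x, ‖g x‖ ^ 2) = ∫⁻ x, ‖g x‖ₑ ^ 2 := by
  have hi : Integrable fun x => ‖g x‖ ^ 2 := (g.memLp 2).integrable_norm_pow (by norm_num)
  rw [ofReal_integral_eq_lintegral_ofReal hi (.of_forall fun x => by positivity)]
  simp_rw [ENNReal.ofReal_pow (norm_nonneg _), ofReal_norm]

lemma prod_ofReal_mul_prod_ofReal {n m : ℕ} (α : Fin m → ℝ)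
    (ξ : Fin m → EuclideanSpace ℝ (Fin n)) :
    (∏ k, ENNReal.ofReal ((1 + 4 * π ^ 2 * ‖ξ k‖ ^ 2) ^ (α k / 2))) *
      ∏ k, ENNReal.ofReal ((1 + 4 * π ^ 2 * ‖ξ k‖ ^ 2) ^ (-(α k / 2))) = 1 := by
  rw [← Finset.prod_mul_distrib]
  refine Finset.prod_eq_one fun k _ => ?_
  rw [← ENNReal.ofReal_mul (by positivity), ← Real.rpow_add (by positivity)]
  simp

open FourierTransform in
lemma lintegral_diagonal_sq_le {n m : ℕ} (hm : 1 ≤ m) {α : Fin m → ℝ} (hα : ∀ k, 0 < α k)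
    (f : SchwartzMap (Fin m → EuclideanSpace ℝ (Fin n)) ℂ) :
    ∫⁻ x : EuclideanSpace ℝ (Fin n), ‖f (fun _ => x)‖ₑ ^ 2 ≤
      multiplierConv n α 0 * LamStar (fun x => f x) α := by
  simp_rw [← diagonalTrace_apply hm f]
  obtain ⟨g, hg⟩ : ∃ g, g = diagonalTrace hm f := ⟨_, rfl⟩
  rw [← hg]
  let h : SchwartzMap (EuclideanSpace ℝ (Fin n)) ℂ :=
    SchwartzMap.postcompCLM (𝕜 := ℝ) Complex.conjCLE.toContinuousLinearMap g
  have hh : ∀ x, h x = (starRingEnd ℂ) (g x) := fun x => rfl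
  set N := ∫⁻ x : EuclideanSpace ℝ (Fin n), ‖g x‖ₑ ^ 2
  have hN : N ≠ ⊤ := by
    simp only [N, ← ofReal_integral_norm_sq]; exact ENNReal.ofReal_ne_top
  obtain ⟨H, hHh⟩ : ∃ H : EuclideanSpace ℝ (Fin n) → ℂ,
      H = 𝓕 (h : EuclideanSpace ℝ (Fin n) → ℂ) := ⟨_, rfl⟩
  have hH : ∫⁻ η, ‖H η‖ₑ ^ 2 = N := by
    rw [hHh, ← SchwartzMap.fourier_coe, ← ofReal_integral_norm_sq,
      SchwartzMap.integral_norm_sq_fourier, ofReal_integral_norm_sq]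
    simp [hh, N]
  have hpair : N = ‖∫ x, f (fun _ => x) * h x‖ₑ := by
    have : ∀ x, f (fun _ => x) * h x = ((‖g x‖ ^ 2 : ℝ) : ℂ) := fun x => by
      rw [hh, ← diagonalTrace_apply hm, ← hg, Complex.mul_conj, Complex.normSq_eq_norm_sq]
    simp_rw [this]
    rw [integral_complex_ofReal, ← ofReal_norm, Complex.norm_real, Real.norm_of_nonneg
      (integral_nonneg fun x => by positivity), ofReal_integral_norm_sq]
  have hcH : Continuous H := by
    rw [hHh, ← SchwartzMap.fourier_coe]; exact SchwartzMap.continuous _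
  have hle : N ≤ ∫⁻ ξ, ‖fourierM (fun x => f x) ξ‖ₑ *
      ‖H (∑ k, ξ k)‖ₑ := by
    rw [hpair, integral_diagonal_mul f h.integrable, ← hHh]
    refine (enorm_integral_le_lintegral_enorm _).trans_eq ?_
    simp_rw [enorm_mul]
  have hcF := continuous_fourierM f
  have hψ := lintegral_multiplier_mul_comp_sum hm hα (ψ := fun η => ‖H η‖ₑ ^ 2) (by fun_prop)
  have hCS := sq_lintegral_mul_le (μ := (volume : Measure (Fin m → EuclideanSpace ℝ (Fin n))))
    (U := fun ξ => ‖fourierM (fun x => f x) ξ‖ₑ) (V := fun ξ => ‖H (∑ k, ξ k)‖ₑ)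
    (by fun_prop)
    (hcH.comp (continuous_finsetSum _ fun k _ => continuous_apply k)).measurable.enorm (by fun_prop) (by fun_prop) (prod_ofReal_mul_prod_ofReal α)
  have hK : ∫⁻ η, ‖H η‖ₑ ^ 2 * multiplierConv n α η ≤ N * multiplierConv n α 0 := by
    rw [← hH, ← lintegral_mul_const _ (by fun_prop)]
    exact lintegral_mono fun η => mul_le_mul_right (multiplierConv_le hα η) _
  rw [hψ] at hCS
  have hfin : N ^ 2 ≤ LamStar (fun x => f x) α * (N * multiplierConv n α 0) :=
    (pow_le_pow_left' hle 2).trans (hCS.trans (mul_le_mul_right hK _))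
  refine le_of_sq_le_mul hN (hfin.trans_eq ?_)
  rw [mul_comm N, ← mul_assoc, mul_comm (LamStar _ _)]

/-- The Gaussian whose Fourier transform is `exp (-π t |η|²)`. -/
def dualGaussian (n : ℕ) (t : ℝ) (x : EuclideanSpace ℝ (Fin n)) : ℂ :=
  ((t ^ (-((n : ℝ) / 2)) : ℝ) : ℂ) * Complex.exp (-((π / t : ℝ) : ℂ) * ‖x‖ ^ 2)

lemma integrable_dualGaussian (n : ℕ) {t : ℝ} (ht : 0 < t) : Integrable (dualGaussian n t) := by
  have h := GaussianFourier.integrable_cexp_neg_mul_sq_norm_add (V := EuclideanSpace ℝ (Fin n))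
    (b := ((π / t : ℝ) : ℂ)) (by rw [Complex.ofReal_re]; positivity) 0 0
  simp only [inner_zero_left, Complex.ofReal_zero, mul_zero, add_zero] at h
  exact h.const_mul _

open FourierTransform in
lemma fourier_dualGaussian (n : ℕ) {t : ℝ} (ht : 0 < t) (η : EuclideanSpace ℝ (Fin n)) :
    𝓕 (dualGaussian n t) η = ((Real.exp (-(π * t * ‖η‖ ^ 2)) : ℝ) : ℂ) := by
  have h := fourier_gaussian_innerProductSpace (V := EuclideanSpace ℝ (Fin n))
    (b := ((π / t : ℝ) : ℂ)) (by rw [Complex.ofReal_re]; positivity) η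
  have hmul : 𝓕 (dualGaussian n t) η = ((t ^ (-((n : ℝ) / 2)) : ℝ) : ℂ) *
      𝓕 (fun x : EuclideanSpace ℝ (Fin n) => Complex.exp (-((π / t : ℝ) : ℂ) * ‖x‖ ^ 2)) η := by
    simp only [Real.fourier_eq', dualGaussian, smul_eq_mul]
    rw [← integral_const_mul]
    refine integral_congr_ae (.of_forall fun x => ?_)
    simp only
    ring
  have h1 : (π : ℂ) / ((π / t : ℝ) : ℂ) = (t : ℂ) := by
    rw [← Complex.ofReal_div]
    congr 1
    field_simp
  have h2 : -(π : ℂ) ^ 2 * (‖η‖ : ℂ) ^ 2 / ((π / t : ℝ) : ℂ) =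
      ((-(π * t * ‖η‖ ^ 2) : ℝ) : ℂ) := by
    norm_cast
    field_simp
  have h3 : (t : ℂ) ^ ((n : ℂ) / 2) = ((t ^ ((n : ℝ) / 2) : ℝ) : ℂ) := by
    rw [Complex.ofReal_cpow ht.le]
    push_cast
    rfl
  rw [hmul, h, finrank_euclideanSpace_fin, h1, h2, h3, ← Complex.ofReal_exp, ← mul_assoc,
    ← Complex.ofReal_mul, ← Real.rpow_add ht]
  simp

lemma enorm_dualGaussian (n : ℕ) {t : ℝ} (ht : 0 < t) (x : EuclideanSpace ℝ (Fin n)) :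
    ‖dualGaussian n t x‖ₑ =
      ENNReal.ofReal (t ^ (-((n : ℝ) / 2)) * Real.exp (-(π * t⁻¹ * ‖x‖ ^ 2))) := by
  have h : dualGaussian n t x =
      ((t ^ (-((n : ℝ) / 2)) * Real.exp (-(π * t⁻¹ * ‖x‖ ^ 2)) : ℝ) : ℂ) := by
    rw [dualGaussian, Complex.ofReal_mul, Complex.ofReal_exp]
    congr 2
    push_cast
    ring
  rw [h, ← ofReal_norm, Complex.norm_real, Real.norm_of_nonneg (by positivity)]

lemma lintegral_dualGaussian_sq (n : ℕ) {t : ℝ} (ht : 0 < t) :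
    ∫⁻ x, ‖dualGaussian n t x‖ₑ ^ 2 = ENNReal.ofReal ((2 * t) ^ (-((n : ℝ) / 2))) := by
  have h : ∀ x : EuclideanSpace ℝ (Fin n), ‖dualGaussian n t x‖ₑ ^ 2 =
      ENNReal.ofReal (t ^ (-((n : ℝ) / 2)) * t ^ (-((n : ℝ) / 2))) *
        ENNReal.ofReal (Real.exp (-(π * (2 * t⁻¹) * ‖x‖ ^ 2))) := by
    intro x
    rw [enorm_dualGaussian n ht, ← ENNReal.ofReal_pow (by positivity),
      ← ENNReal.ofReal_mul (by positivity), mul_pow, ← Real.exp_nat_mul, pow_two]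
    congr 3
    push_cast
    ring
  simp_rw [h]
  rw [lintegral_const_mul _ (by fun_prop), lintegral_gaussian (by positivity),
    ← ENNReal.ofReal_mul (by positivity), ← Real.mul_rpow ht.le ht.le,
    ← Real.mul_rpow (by positivity) (by positivity)]
  congr 2
  field_simp

/-- Real-valued product of the Bessel potential multipliers. -/
def multiplier {n m : ℕ} (α : Fin m → ℝ) (ξ : Fin m → EuclideanSpace ℝ (Fin n)) : ℝ :=
  ∏ k, (1 + 4 * π ^ 2 * ‖ξ k‖ ^ 2) ^ (-(α k / 2))

lemma multiplier_pos {n m : ℕ} (α : Fin m → ℝ) (ξ : Fin m → EuclideanSpace ℝ (Fin n)) :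
    0 < multiplier α ξ :=
  Finset.prod_pos fun k _ => Real.rpow_pos_of_pos (by positivity) _

lemma ofReal_multiplier {n m : ℕ} (α : Fin m → ℝ) (ξ : Fin m → EuclideanSpace ℝ (Fin n)) :
    ENNReal.ofReal (multiplier α ξ) =
      ∏ k, ENNReal.ofReal ((1 + 4 * π ^ 2 * ‖ξ k‖ ^ 2) ^ (-(α k / 2))) :=
  ENNReal.ofReal_prod_of_nonneg fun k _ => Real.rpow_nonneg (by positivity) _

open scoped ContDiff in
lemma contDiff_multiplier {n m : ℕ} (α : Fin m → ℝ) :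
    ContDiff ℝ ∞ (multiplier α : (Fin m → EuclideanSpace ℝ (Fin n)) → ℝ) := by
  refine contDiff_prod fun k _ => ContDiff.rpow_const_of_ne ?_ fun ξ => by positivity
  exact contDiff_const.add (contDiff_const.mul ((contDiff_apply ℝ _ k).norm_sq ℝ))

open scoped ContDiff in
/-- A compactly supported trial function on the Fourier side. -/
lemma exists_schwartz_trial {n m : ℕ} (α : Fin m → ℝ) (t : ℝ)
    (ρ : ContDiffBump (0 : Fin m → EuclideanSpace ℝ (Fin n))) :
    ∃ F : SchwartzMap (Fin m → EuclideanSpace ℝ (Fin n)) ℂ, ∀ ξ, F ξ =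
      ((multiplier α ξ * Real.exp (-(π * t * ‖∑ k, ξ k‖ ^ 2)) * ρ ξ : ℝ) : ℂ) := by
  have hsum : ContDiff ℝ ∞ fun ξ : Fin m → EuclideanSpace ℝ (Fin n) => ∑ k, ξ k :=
    ContDiff.sum fun k _ => contDiff_apply ℝ _ k
  have hexp : ContDiff ℝ ∞ fun ξ : Fin m → EuclideanSpace ℝ (Fin n) =>
      Real.exp (-(π * t * ‖∑ k, ξ k‖ ^ 2)) :=
    (contDiff_const.mul (hsum.norm_sq ℝ)).neg.exp
  refine ⟨HasCompactSupport.toSchwartzMap (f := fun ξ =>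
    ((multiplier α ξ * Real.exp (-(π * t * ‖∑ k, ξ k‖ ^ 2)) * ρ ξ : ℝ) : ℂ)) ?_ ?_, fun ξ => rfl⟩
  · exact (ρ.hasCompactSupport.mul_left (f := fun ξ =>
      multiplier α ξ * Real.exp (-(π * t * ‖∑ k, ξ k‖ ^ 2)))).comp_left Complex.ofReal_zero
  · exact Complex.ofRealCLM.contDiff.comp (((contDiff_multiplier α).mul hexp).mul ρ.contDiff)

/-- The trace inequality with constant `C`, tested on truncations of the near-extremals. -/
lemma lintegral_truncated_le {n m : ℕ} {α : Fin m → ℝ} {C : ℝ≥0∞}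
    (hC : ∀ f : SchwartzMap (Fin m → EuclideanSpace ℝ (Fin n)) ℂ,
      ∫⁻ x : EuclideanSpace ℝ (Fin n), ‖f (fun _ => x)‖ₑ ^ 2 ≤ C * LamStar (fun x => f x) α)
    {t : ℝ} (ht : 0 < t) (ρ : ContDiffBump (0 : Fin m → EuclideanSpace ℝ (Fin n))) :
    ∫⁻ ξ, ENNReal.ofReal (multiplier α ξ * Real.exp (-(π * (2 * t) * ‖∑ k, ξ k‖ ^ 2)) * ρ ξ) ≤
      C * ENNReal.ofReal ((2 * t) ^ (-((n : ℝ) / 2))) := by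
  obtain ⟨F, hF⟩ := exists_schwartz_trial α t ρ
  obtain ⟨f, hf⟩ := exists_fourierM_eq F
  have hexp : ∀ ξ : Fin m → EuclideanSpace ℝ (Fin n),
      Real.exp (-(π * (2 * t) * ‖∑ k, ξ k‖ ^ 2)) = Real.exp (-(π * t * ‖∑ k, ξ k‖ ^ 2)) *
        Real.exp (-(π * t * ‖∑ k, ξ k‖ ^ 2)) := fun ξ => by
    rw [← Real.exp_add]; congr 1; ring
  set I := ∫⁻ ξ, ENNReal.ofReal
    (multiplier α ξ * Real.exp (-(π * (2 * t) * ‖∑ k, ξ k‖ ^ 2)) * ρ ξ) with hI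
  have hnn : ∀ ξ, 0 ≤ multiplier α ξ * Real.exp (-(π * (2 * t) * ‖∑ k, ξ k‖ ^ 2)) * ρ ξ :=
    fun ξ => mul_nonneg (mul_nonneg (multiplier_pos α ξ).le (Real.exp_pos _).le) ρ.nonneg
  have hint : Integrable fun ξ : Fin m → EuclideanSpace ℝ (Fin n) =>
      multiplier α ξ * Real.exp (-(π * (2 * t) * ‖∑ k, ξ k‖ ^ 2)) * ρ ξ := by
    obtain ⟨F₂, hF₂⟩ := exists_schwartz_trial α (2 * t) ρ
    obtain ⟨f₂, hf₂⟩ := exists_fourierM_eq F₂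
    have := integrable_fourierM f₂
    rw [hf₂, funext hF₂] at this
    simpa only [RCLike.re_to_complex, Complex.ofReal_re] using this.re
  have hIeq : ENNReal.ofReal (∫ ξ, multiplier α ξ *
      Real.exp (-(π * (2 * t) * ‖∑ k, ξ k‖ ^ 2)) * ρ ξ) = I :=
    ofReal_integral_eq_lintegral_ofReal hint (.of_forall hnn)
  have hpair : I = ‖∫ x, f (fun _ => x) * dualGaussian n t x‖ₑ := by
    rw [integral_diagonal_mul f (integrable_dualGaussian n ht), hf]
    have : ∀ ξ, F ξ * FourierTransform.fourier (dualGaussian n t) (∑ k, ξ k) =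
        ((multiplier α ξ * Real.exp (-(π * (2 * t) * ‖∑ k, ξ k‖ ^ 2)) * ρ ξ : ℝ) : ℂ) := by
      intro ξ
      rw [hF, fourier_dualGaussian n ht, hexp, ← Complex.ofReal_mul]
      congr 1
      ring
    simp_rw [this]
    rw [integral_complex_ofReal, ← ofReal_norm, Complex.norm_real,
      Real.norm_of_nonneg (integral_nonneg hnn), hIeq]
  have hmeas : Measurable (dualGaussian n t) := by unfold dualGaussian; fun_prop
  have hmf : Measurable fun x : EuclideanSpace ℝ (Fin n) => f (fun _ => x) :=
    (f.continuous.comp (continuous_pi fun _ => continuous_id)).measurable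
  have hle : I ≤ ∫⁻ x, ‖f (fun _ => x)‖ₑ * ‖dualGaussian n t x‖ₑ := by
    rw [hpair]
    refine (enorm_integral_le_lintegral_enorm _).trans_eq ?_
    simp_rw [enorm_mul]
  have hCS := sq_lintegral_mul_le (μ := (volume : Measure (EuclideanSpace ℝ (Fin n))))
    hmf.enorm hmeas.enorm measurable_const measurable_const (fun _ => one_mul (1 : ℝ≥0∞))
  simp only [one_mul] at hCS
  rw [lintegral_dualGaussian_sq n ht] at hCS
  have hLam : LamStar (fun x => f x) α ≤ I := by
    rw [LamStar, hf]
    refine lintegral_mono fun ξ => ?_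
    have hn : (‖F ξ‖₊ : ℝ≥0∞) = ENNReal.ofReal (multiplier α ξ) *
        ENNReal.ofReal (Real.exp (-(π * t * ‖∑ k, ξ k‖ ^ 2)) * ρ ξ) := by
      rw [← ENNReal.ofReal_mul (multiplier_pos α ξ).le, ← enorm_eq_nnnorm, hF, ← ofReal_norm,
        Complex.norm_real, Real.norm_of_nonneg (mul_nonneg (mul_nonneg (multiplier_pos α ξ).le
          (Real.exp_pos _).le) ρ.nonneg), mul_assoc]
    have hW := prod_ofReal_mul_prod_ofReal α ξ
    rw [← ofReal_multiplier] at hW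
    rw [hn, mul_pow, ← mul_assoc, pow_two (ENNReal.ofReal (multiplier α ξ)), ← mul_assoc, hW,
      one_mul, ← ENNReal.ofReal_pow (mul_nonneg (Real.exp_pos _).le ρ.nonneg),
      ← ENNReal.ofReal_mul (multiplier_pos α ξ).le]
    refine ENNReal.ofReal_le_ofReal ?_
    rw [hexp, mul_assoc (multiplier α ξ), mul_pow, pow_two (Real.exp _), pow_two (ρ ξ)]
    refine mul_le_mul_of_nonneg_left (mul_le_mul_of_nonneg_left ?_ (by positivity))
      (multiplier_pos α ξ).le
    exact mul_le_of_le_one_left ρ.nonneg ρ.le_one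
  refine le_of_sq_le_mul (by rw [← hIeq]; exact ENNReal.ofReal_ne_top) ?_
  calc I ^ 2 ≤ (∫⁻ x, ‖f (fun _ => x)‖ₑ * ‖dualGaussian n t x‖ₑ) ^ 2 := pow_le_pow_left' hle 2
    _ ≤ (∫⁻ x, ‖f (fun _ => x)‖ₑ ^ 2) * ENNReal.ofReal ((2 * t) ^ (-((n : ℝ) / 2))) := hCS
    _ ≤ C * I * ENNReal.ofReal ((2 * t) ^ (-((n : ℝ) / 2))) :=
        mul_le_mul_left ((hC f).trans (mul_le_mul_right hLam C)) _
    _ = C * ENNReal.ofReal ((2 * t) ^ (-((n : ℝ) / 2))) * I := mul_right_comm _ _ _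

lemma lintegral_gaussian_mul_multiplierConv_le {n m : ℕ} (hm : 1 ≤ m) {α : Fin m → ℝ}
    (hα : ∀ k, 0 < α k) {C : ℝ≥0∞}
    (hC : ∀ f : SchwartzMap (Fin m → EuclideanSpace ℝ (Fin n)) ℂ,
      ∫⁻ x : EuclideanSpace ℝ (Fin n), ‖f (fun _ => x)‖ₑ ^ 2 ≤ C * LamStar (fun x => f x) α)
    {s : ℝ} (hs : 0 < s) :
    ∫⁻ η, ENNReal.ofReal (Real.exp (-(π * s * ‖η‖ ^ 2))) * multiplierConv n α η ≤
      C * ENNReal.ofReal (s ^ (-((n : ℝ) / 2))) := by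
  rw [← lintegral_multiplier_mul_comp_sum hm hα (by fun_prop)]
  let ρ : ℕ → ContDiffBump (0 : Fin m → EuclideanSpace ℝ (Fin n)) := fun j =>
    ⟨j + 1, j + 2, by positivity, by linarith⟩
  have hlim : ∀ ξ : Fin m → EuclideanSpace ℝ (Fin n),
      Filter.liminf (fun j => ENNReal.ofReal
        (multiplier α ξ * Real.exp (-(π * s * ‖∑ k, ξ k‖ ^ 2)) * ρ j ξ)) Filter.atTop =
      (∏ k, ENNReal.ofReal ((1 + 4 * π ^ 2 * ‖ξ k‖ ^ 2) ^ (-(α k / 2)))) *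
        ENNReal.ofReal (Real.exp (-(π * s * ‖∑ k, ξ k‖ ^ 2))) := by
    intro ξ
    refine Filter.Tendsto.liminf_eq (tendsto_const_nhds.congr' ?_)
    obtain ⟨N, hN⟩ := exists_nat_ge ‖ξ‖
    filter_upwards [Filter.eventually_ge_atTop N] with j hj
    have h1 : ρ j ξ = 1 := by
      refine (ρ j).one_of_mem_closedBall ?_
      rw [mem_closedBall_zero_iff]
      have : (N : ℝ) ≤ j := by exact_mod_cast hj
      change ‖ξ‖ ≤ (j : ℝ) + 1
      linarith
    rw [h1, mul_one, ENNReal.ofReal_mul (multiplier_pos α ξ).le, ofReal_multiplier]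
  simp_rw [← hlim]
  refine (lintegral_liminf_le fun j => ?_).trans ?_
  · have := (contDiff_multiplier (n := n) α).continuous
    have := (ρ j).continuous
    fun_prop
  · refine Filter.liminf_le_of_le (by isBoundedDefault) fun b hb => ?_
    obtain ⟨j, hj⟩ := hb.exists
    refine hj.trans ?_
    have := lintegral_truncated_le hC (half_pos hs) (ρ j)
    rwa [mul_div_cancel₀ _ (two_ne_zero' ℝ)] at this

lemma multiplierConv_zero_le {n m : ℕ} (hm : 1 ≤ m) {α : Fin m → ℝ} (hα : ∀ k, 0 < α k)
    {C : ℝ≥0∞} (hC : ∀ s : ℝ, 0 < s →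
      ∫⁻ η, ENNReal.ofReal (Real.exp (-(π * s * ‖η‖ ^ 2))) * multiplierConv n α η ≤
        C * ENNReal.ofReal (s ^ (-((n : ℝ) / 2)))) :
    multiplierConv n α 0 ≤ C := by
  have := isProbabilityMeasure_jointSubordinator hα
  have hbound : ∀ s : ℝ, 0 < s → ∫⁻ δ, ENNReal.ofReal (gaussFactor n δ *
      (1 + s⁻¹ * (∑ k, (δ k)⁻¹)⁻¹) ^ (-((n : ℝ) / 2))) ∂(jointSubordinator α) ≤ C := by
    intro s hs
    have hpos : 0 < s ^ (-((n : ℝ) / 2)) := Real.rpow_pos_of_pos hs _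
    refine (ENNReal.mul_le_mul_iff_left (ENNReal.ofReal_pos.2 hpos).ne'
      ENNReal.ofReal_ne_top).1 (le_trans (le_of_eq ?_) (hC s hs))
    simp_rw [multiplierConv]
    rw [← lintegral_mul_const _ (by fun_prop), lintegral_congr fun η =>
      (lintegral_const_mul _ (by fun_prop)).symm, lintegral_lintegral_swap (by fun_prop)]
    refine lintegral_congr_ae ((ae_pos_jointSubordinator hα).mono fun δ hδ => ?_)
    have hS := sum_inv_pos hm hδ
    beta_reduce
    set S := ∑ k, (δ k)⁻¹
    have h1 : ∀ η : EuclideanSpace ℝ (Fin n), ENNReal.ofReal (Real.exp (-(π * s * ‖η‖ ^ 2))) *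
        ENNReal.ofReal (gaussFactor n δ * Real.exp (-(π * S⁻¹ * ‖η‖ ^ 2))) =
        ENNReal.ofReal (gaussFactor n δ) *
          ENNReal.ofReal (Real.exp (-(π * (s + S⁻¹) * ‖η‖ ^ 2))) := by
      intro η
      rw [← ENNReal.ofReal_mul (by positivity), ← ENNReal.ofReal_mul (gaussFactor_nonneg hδ),
        mul_left_comm, ← Real.exp_add]
      congr 3
      ring
    rw [lintegral_congr h1, lintegral_const_mul _ (by fun_prop), lintegral_gaussian (by positivity),
      ← ENNReal.ofReal_mul' hpos.le, ← ENNReal.ofReal_mul (gaussFactor_nonneg hδ), mul_assoc,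
      ← Real.mul_rpow (by positivity) hs.le]
    congr 3
    field_simp
  have hlim : ∀ δ : Fin m → ℝ, Filter.Tendsto (fun j : ℕ => ENNReal.ofReal (gaussFactor n δ *
      (1 + ((j : ℝ) + 1)⁻¹ * (∑ k, (δ k)⁻¹)⁻¹) ^ (-((n : ℝ) / 2)))) Filter.atTop
      (nhds (ENNReal.ofReal (gaussFactor n δ * Real.exp (-(π * (∑ k, (δ k)⁻¹)⁻¹ *
        ‖(0 : EuclideanSpace ℝ (Fin n))‖ ^ 2))))) := by
    intro δ
    refine ENNReal.tendsto_ofReal (Filter.Tendsto.const_mul _ ?_)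
    have h0 : Filter.Tendsto (fun j : ℕ => 1 + ((j : ℝ) + 1)⁻¹ * (∑ k, (δ k)⁻¹)⁻¹) Filter.atTop
        (nhds (1 + 0 * (∑ k, (δ k)⁻¹)⁻¹)) := by
      refine Filter.Tendsto.const_add _ (Filter.Tendsto.mul_const _ ?_)
      simpa only [one_div] using tendsto_one_div_add_atTop_nhds_zero_nat (𝕜 := ℝ)
    have h1 := h0.rpow_const (p := -((n : ℝ) / 2)) (Or.inl (by simp))
    simpa using h1
  rw [multiplierConv, lintegral_congr fun δ => (hlim δ).liminf_eq.symm]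
  refine (lintegral_liminf_le fun j => by fun_prop).trans ?_
  refine Filter.liminf_le_of_le (by isBoundedDefault) fun b hb => ?_
  obtain ⟨j, hj⟩ := hb.exists
  exact hj.trans (hbound _ (by positivity))

/-- **Sharp `L²` Gagliardo–Nirenberg trace inequality.**
For `0 < α_k < n` with `Σ α_k > (m−1)n`,
`∫ |f(x,…,x)|² dx ≤ (∫ Π_k G_{α_k}) Λ_*(f; α)`, with least constant `∫ Π_k G_{α_k}`. -/
theorem stmt16 (m n : ℕ) (hm : 1 ≤ m) (hn : 1 ≤ n)
    (α : Fin m → ℝ) (hα : ∀ k, 0 < α k ∧ α k < n)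
    (hlow : ((m : ℝ) - 1) * n < ∑ k, α k) :
    (∀ f : SchwartzMap (Fin m → EuclideanSpace ℝ (Fin n)) ℂ,
      (∫⁻ x : EuclideanSpace ℝ (Fin n), (‖f (fun _ => x)‖₊ : ℝ≥0∞) ^ (2 : ℕ)) ≤
        ENNReal.ofReal (∫ x : EuclideanSpace ℝ (Fin n), ∏ k, besselG n (α k) x) *
          LamStar (fun x => f x) α) ∧
    (∀ C : ℝ≥0∞,
      (∀ f : SchwartzMap (Fin m → EuclideanSpace ℝ (Fin n)) ℂ,
        (∫⁻ x : EuclideanSpace ℝ (Fin n), (‖f (fun _ => x)‖₊ : ℝ≥0∞) ^ (2 : ℕ)) ≤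
          C * LamStar (fun x => f x) α) →
      ENNReal.ofReal (∫ x : EuclideanSpace ℝ (Fin n), ∏ k, besselG n (α k) x) ≤ C) := by
  have hα₀ := fun k => (hα k).1
  rw [ofReal_integral_prod_besselG hm hn hα hlow]
  exact ⟨fun f => lintegral_diagonal_sq_le hm hα₀ f, fun C hC => multiplierConv_zero_le hm hα₀
    fun s hs => lintegral_gaussian_mul_multiplierConv_le hm hα₀ hC hs⟩
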